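/- Let buyer i have a Cobb-Douglas utility (ρ_i = 0) with coefficients a_ij > 0, Σ_j a_ij = 1, budget e_i > 0, and equilibrium spending b*_ij = e_i·a_ij. Suppose her spending evolves by the damped update b_ij^{t+1} = e_i·(b_ij^t · a_ij)^{1/2} / Σ_k (b_ik^t · a_ik)^{1/2} starting from an entrywise positive b_i^0 with Σ_j b_ij^0 = e_i. Then KL(b_i* ‖ b_i^t) ≥ 2·KL(b_i* ‖ b_i^{t+1}) for every t ≥ 0, and consequently KL(b_i* ‖ b_i^0) ≥ Σ_{t=1}^{T} KL(b_i* ‖ b_i^t) for every T ≥ 1. -/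

import Mathlib

/-- KL divergence between two nonnegative vectors. -/
noncomputable def KL {n : ℕ} (x y : Fin n → ℝ) : ℝ :=
  ∑ j, x j * Real.log (x j / y j)

/-- Gibbs' inequality for positive vectors of equal total mass. -/
theorem KL_nonneg {n : ℕ} {x y : Fin n → ℝ} (hx : ∀ j, 0 < x j) (hy : ∀ j, 0 < y j)
    (hsum : ∑ j, x j = ∑ j, y j) : 0 ≤ KL x y := by
  have h : ∑ j, (x j - y j) ≤ KL x y := by
    refine Finset.sum_le_sum fun j _ => ?_
    have h1 := Real.one_sub_inv_le_log_of_pos (div_pos (hx j) (hy j))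
    have h2 := mul_le_mul_of_nonneg_left h1 (hx j).le
    rwa [inv_div, mul_sub, mul_one, mul_div_cancel₀ _ (hx j).ne'] at h2
  rwa [Finset.sum_sub_distrib, hsum, sub_self] at h

/-- The normalizer of the damped update is positive. -/
theorem sum_sqrt_mul_pos {n : ℕ} {a y : Fin n → ℝ} (ha : ∀ j, 0 < a j)
    (hasum : ∑ j, a j = 1) (hy : ∀ j, 0 < y j) : 0 < ∑ k, √(y k * a k) := by
  have hne : (Finset.univ : Finset (Fin n)).Nonempty := by
    by_contra h
    rw [Finset.not_nonempty_iff_eq_empty] at h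
    simp [h] at hasum
  exact Finset.sum_pos (fun j _ => Real.sqrt_pos.2 (mul_pos (hy j) (ha j))) hne

/-- One damped step from a positive vector `y` of total mass `e` at least halves the divergence
from `e • a`. -/
theorem two_mul_KL_damped_le {n : ℕ} {e : ℝ} (he : 0 < e) {a y : Fin n → ℝ}
    (ha : ∀ j, 0 < a j) (hasum : ∑ j, a j = 1) (hy : ∀ j, 0 < y j) (hysum : ∑ j, y j = e) :
    2 * KL (fun j => e * a j) (fun j => e * √(y j * a j) / ∑ k, √(y k * a k)) ≤
      KL (fun j => e * a j) y := by
  have hZ := sum_sqrt_mul_pos ha hasum hy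
  set Z := ∑ k, √(y k * a k)
  have hCS : Z ^ 2 ≤ e := by
    have h := Finset.sum_sq_le_sum_mul_sum_of_sq_le_mul Finset.univ
      (fun j _ => (hy j).le) (fun j _ => (ha j).le)
      (fun j _ => (Real.sq_sqrt (mul_pos (hy j) (ha j)).le).le)
    rwa [hysum, hasum, mul_one] at h
  have hlog : 2 * Real.log Z ≤ Real.log e := by
    have h := Real.log_le_log (pow_pos hZ 2) hCS
    rwa [Real.log_pow] at h
  simp only [KL]
  rw [Finset.mul_sum]
  refine Finset.sum_le_sum fun j _ => ?_
  have haj := ha j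
  have hyj := hy j
  have hs : 0 < √(y j * a j) := Real.sqrt_pos.2 (mul_pos hyj haj)
  rw [Real.log_div (mul_pos he haj).ne' (div_pos (mul_pos he hs) hZ).ne',
    Real.log_div (mul_pos he haj).ne' hyj.ne', Real.log_div (mul_pos he hs).ne' hZ.ne',
    Real.log_mul he.ne' hs.ne', Real.log_mul he.ne' haj.ne',
    Real.log_sqrt (mul_pos hyj haj).le, Real.log_mul hyj.ne' haj.ne']
  have h := mul_le_mul_of_nonneg_left hlog (mul_pos he haj).le
  linear_combination h

/-- For a Cobb-Douglas buyer, the damped update halves the KL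
divergence to her equilibrium spending `b*_j = e·a_j` at every step, and hence the
sum of the divergences along the trajectory is bounded by the initial divergence. -/
theorem cobb_douglas_damped_update_halves_KL {n : ℕ}
    (e : ℝ) (he : 0 < e)
    (a : Fin n → ℝ) (ha : ∀ j, 0 < a j) (hasum : ∑ j, a j = 1)
    (bstar : Fin n → ℝ) (hbstar : ∀ j, bstar j = e * a j)
    (b : ℕ → Fin n → ℝ)
    (hb0pos : ∀ j, 0 < b 0 j) (hb0sum : ∑ j, b 0 j = e)
    -- the damped update
    (hupd : ∀ t j, b (t + 1) j =
      e * (b t j * a j) ^ ((1 : ℝ) / 2) / ∑ k, (b t k * a k) ^ ((1 : ℝ) / 2)) :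
    (∀ t : ℕ, 2 * KL bstar (b (t + 1)) ≤ KL bstar (b t)) ∧
    ∀ T : ℕ, 1 ≤ T → ∑ t ∈ Finset.Icc 1 T, KL bstar (b t) ≤ KL bstar (b 0) := by
  obtain rfl : bstar = fun j => e * a j := funext hbstar
  simp only [← Real.sqrt_eq_rpow] at hupd
  have hinv : ∀ t, (∀ j, 0 < b t j) ∧ ∑ j, b t j = e := by
    intro t
    induction t with
    | zero => exact ⟨hb0pos, hb0sum⟩
    | succ t ih =>
      have hZ := sum_sqrt_mul_pos ha hasum ih.1
      constructor
      · intro j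
        rw [hupd]
        exact div_pos (mul_pos he (Real.sqrt_pos.2 (mul_pos (ih.1 j) (ha j)))) hZ
      · simp only [hupd]
        rw [← Finset.sum_div, ← Finset.mul_sum, mul_div_cancel_right₀ _ hZ.ne']
  have hstep : ∀ t, 2 * KL (fun j => e * a j) (b (t + 1)) ≤ KL (fun j => e * a j) (b t) := by
    intro t
    rw [show b (t + 1) = _ from funext (hupd t)]
    exact two_mul_KL_damped_le he ha hasum (hinv t).1 (hinv t).2
  refine ⟨hstep, fun T _ => ?_⟩
  have hnonneg : 0 ≤ KL (fun j => e * a j) (b T) :=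
    KL_nonneg (fun j => mul_pos he (ha j)) (hinv T).1
      (by rw [← Finset.mul_sum, hasum, mul_one, (hinv T).2])
  have htel : ∀ S : ℕ, ∑ t ∈ Finset.Icc 1 S, KL (fun j => e * a j) (b t) +
      KL (fun j => e * a j) (b S) ≤ KL (fun j => e * a j) (b 0) := by
    intro S
    induction S with
    | zero => simp
    | succ S ih =>
      rw [Finset.sum_Icc_succ_top (by omega)]
      linarith [hstep S]
  linarith [htel T]
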